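/- (Local SafeToOpen Lemma, part 5) In a regular run, let x be a track with significant moments 0 = t_0 < t_1 < t_2 < …, and let s(x,t) denote the condition: TrackStatus(x,t) = empty or t + d_open < Deadline(x,t). If [α,β) or [α,β] is a maximal positive interval of s(x) (that is, [α,β) = [t_{3i}, t_{3i+1} + WaitTime − d_open) when WaitTime > d_open, or [α,β] = [t_{3i}, t_{3i+1}] when WaitTime ≤ d_open), then Deadline(x,t) ≠ t for every t ∈ [α,β] and for every t in some nonempty interval (β, β+ε); that is, the rule SignalClose(x) is disabled over [α,β] and at β+. -/

import Mathlib

namespace RailCross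

inductive TStat : Type
  | emp | coming | incrossing
deriving DecidableEq

inductive DirV : Type
  | opn | cls
deriving DecidableEq

inductive GateV : Type
  | opened | closed
deriving DecidableEq

/-- `f` is piecewise constant on `[0, ∞)`: for every `τ > 0` there is a finite
partition `0 = s 0 < s 1 < … < s n = τ` such that `f` is constant on each open
subinterval `(s i, s (i+1))`. -/
def PWC {Y : Type*} (f : ℝ → Y) : Prop :=
  ∀ τ : ℝ, 0 < τ → ∃ n : ℕ, ∃ s : ℕ → ℝ,
    s 0 = 0 ∧ s n = τ ∧ (∀ i < n, s i < s (i + 1)) ∧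
    (∀ i < n, ∀ a b : ℝ, s i < a → a < b → b < s (i + 1) → f a = f b)

/-- `v` is the right-hand value `f(t+)`: `f` is constantly `v` on some `(t, t+ε)`. -/
def RightVal {Y : Type*} (f : ℝ → Y) (t : ℝ) (v : Y) : Prop :=
  ∃ ε : ℝ, 0 < ε ∧ ∀ u : ℝ, t < u → u < t + ε → f u = v

/-- `v` is the left-hand value `f(t−)` (for `t > 0`): `f` is constantly `v` on some `(t-ε, t)`. -/
def LeftVal {Y : Type*} (f : ℝ → Y) (t : ℝ) (v : Y) : Prop :=
  ∃ ε : ℝ, 0 < ε ∧ ε ≤ t ∧ ∀ u : ℝ, t - ε < u → u < t → f u = v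

/-- `tm` is the (finite or infinite) increasing sequence of significant moments of a
track with status function `f`; a finite sequence is encoded by letting `tm` take the
value `⊤ = ∞` from some point on. -/
structure TrainMotion (dmin dmax : ℝ) (f : ℝ → TStat) (tm : ℕ → EReal) : Prop where
  zero : tm 0 = 0
  mono : Monotone tm
  strict : ∀ i, tm i ≠ ⊤ → tm i < tm (i + 1)
  last_div : ∀ k, tm k ≠ ⊤ → tm (k + 1) = ⊤ → 3 ∣ k
  status_empty : ∀ i : ℕ, ∀ u : ℝ, tm (3 * i) ≤ (u : EReal) → (u : EReal) < tm (3 * i + 1) →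
    f u = TStat.emp
  status_coming : ∀ i : ℕ, ∀ u : ℝ, tm (3 * i + 1) ≤ (u : EReal) → (u : EReal) < tm (3 * i + 2) →
    f u = TStat.coming
  status_cross : ∀ i : ℕ, ∀ u : ℝ, tm (3 * i + 2) ≤ (u : EReal) → (u : EReal) < tm (3 * i + 3) →
    f u = TStat.incrossing
  gap : ∀ i : ℕ, ∀ a b : ℝ, tm (3 * i + 1) = (a : EReal) → tm (3 * i + 2) = (b : EReal) →
    dmin ≤ b - a ∧ b - a ≤ dmax

/-- `SafeToOpen(t)`: every track is empty or its deadline is more than `dopen` away. -/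
def SafeToOpen {Tracks : Type*} (dopen : ℝ) (trackStatus : Tracks → ℝ → TStat)
    (deadline : Tracks → ℝ → EReal) (t : ℝ) : Prop :=
  ∀ x : Tracks, trackStatus x t = TStat.emp ∨ ((t + dopen : ℝ) : EReal) < deadline x t

/-- A regular run of the railroad-crossing evolving algebra.  `WaitTime = dmin - dclose`. -/
structure RegularRun (Tracks : Type*) (dmin dmax dopen dclose : ℝ) where
  trackStatus : Tracks → ℝ → TStat
  deadline : Tracks → ℝ → EReal
  dir : ℝ → DirV
  gate : ℝ → GateV
  /-- the right-hand value `Deadline(x, t+)` -/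
  deadlinePlus : Tracks → ℝ → EReal
  /-- the right-hand value `Dir(t+)` -/
  dirPlus : ℝ → DirV
  /-- the right-hand value `GateStatus(t+)` -/
  gatePlus : ℝ → GateV
  pwc_ts : ∀ x, PWC (trackStatus x)
  pwc_dl : ∀ x, PWC (deadline x)
  pwc_dir : PWC dir
  pwc_gate : PWC gate
  dlPlus_spec : ∀ x, ∀ t : ℝ, 0 ≤ t → RightVal (deadline x) t (deadlinePlus x t)
  dirPlus_spec : ∀ t : ℝ, 0 ≤ t → RightVal dir t (dirPlus t)
  gatePlus_spec : ∀ t : ℝ, 0 ≤ t → RightVal gate t (gatePlus t)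
  dl_left : ∀ x, ∀ t : ℝ, 0 < t → LeftVal (deadline x) t (deadline x t)
  dir_left : ∀ t : ℝ, 0 < t → LeftVal dir t (dir t)
  gate_left : ∀ t : ℝ, 0 < t → LeftVal gate t (gate t)
  trainMotion : ∀ x, ∃ tm : ℕ → EReal, TrainMotion dmin dmax (trackStatus x) tm
  dl_init : ∀ x, deadline x 0 = ⊤
  dir_init : dir 0 = DirV.opn
  gate_init : gate 0 = GateV.opened
  dl_step_coming : ∀ x, ∀ t : ℝ, 0 ≤ t → trackStatus x t = TStat.coming → deadline x t = ⊤ →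
    deadlinePlus x t = ((t + (dmin - dclose) : ℝ) : EReal)
  dl_step_empty : ∀ x, ∀ t : ℝ, 0 ≤ t → trackStatus x t = TStat.emp → deadline x t ≠ ⊤ →
    deadlinePlus x t = ⊤
  dl_step_other : ∀ x, ∀ t : ℝ, 0 ≤ t →
    ¬(trackStatus x t = TStat.coming ∧ deadline x t = ⊤) →
    ¬(trackStatus x t = TStat.emp ∧ deadline x t ≠ ⊤) →
    deadlinePlus x t = deadline x t
  dir_step_close : ∀ t : ℝ, 0 ≤ t → (∃ x, deadline x t = (t : EReal)) → dirPlus t = DirV.cls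
  dir_step_open : ∀ t : ℝ, 0 ≤ t → (∀ x, deadline x t ≠ (t : EReal)) → dir t = DirV.cls →
    SafeToOpen dopen trackStatus deadline t → dirPlus t = DirV.opn
  dir_step_other : ∀ t : ℝ, 0 ≤ t → (∀ x, deadline x t ≠ (t : EReal)) →
    ¬(dir t = DirV.cls ∧ SafeToOpen dopen trackStatus deadline t) → dirPlus t = dir t
  gate_step : ∀ t : ℝ, 0 ≤ t →
    gatePlus t = gate t ∨ (dir t = DirV.opn ∧ gatePlus t = GateV.opened) ∨
      (dir t = DirV.cls ∧ gatePlus t = GateV.closed)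
  gate_close_bound : ∀ t : ℝ, 0 ≤ t →
    ¬(∀ u ∈ Set.Ioo t (t + dclose), dir u = DirV.cls ∧ gate u = GateV.opened)
  gate_open_bound : ∀ t : ℝ, 0 ≤ t →
    ¬(∀ u ∈ Set.Ioo t (t + dopen), dir u = DirV.opn ∧ gate u = GateV.closed)

theorem eq_on_Ioc_of_leftVal_of_rightVal {Y : Type*} {f : ℝ → Y} {v : Y} {a b : ℝ}
    (hstart : RightVal f a v)
    (hright : ∀ t, a < t → t < b → f t = v → RightVal f t v)
    (hleft : ∀ t, a < t → t ≤ b → LeftVal f t (f t)) :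
    ∀ t ∈ Set.Ioc a b, f t = v := by
  rintro t₀ ⟨hat, htb⟩
  let S : Set ℝ := {t | t ≤ t₀ ∧ ∀ u, a < u → u ≤ t → f u = v}
  have haS : a ∈ S := ⟨hat.le, fun u h₁ h₂ => absurd h₁ h₂.not_gt⟩
  have hbdd : BddAbove S := ⟨t₀, fun t ht => ht.1⟩
  have hsup : IsLUB S (sSup S) := isLUB_csSup ⟨a, haS⟩ hbdd
  set c := sSup S
  have hac : a ≤ c := hsup.1 haS
  have hct : c ≤ t₀ := hsup.2 fun t ht => ht.1
  have hlt : ∀ u, a < u → u < c → f u = v := by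
    intro u hu huc
    obtain ⟨w, hw, huw⟩ := (lt_isLUB_iff hsup).1 huc
    exact hw.2 u hu huw.le
  have hcv : a < c → f c = v := by
    intro h
    obtain ⟨ε, hε, -, hu⟩ := hleft c h (hct.trans htb)
    have hm : max a (c - ε) < c := max_lt h (by linarith)
    obtain ⟨w, hw₁, hw₂⟩ := exists_between hm
    rw [max_lt_iff] at hw₁
    rw [← hu w hw₁.2 hw₂]
    exact hlt w hw₁.1 hw₂
  rcases hct.eq_or_lt with heq | hlt'
  · rw [← heq]
    exact hcv (heq ▸ hat)
  · have hr : RightVal f c v := by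
      rcases hac.eq_or_lt with heq | h
      · exact heq ▸ hstart
      · exact hright c h (hlt'.trans_le htb) (hcv h)
    obtain ⟨ε, hε, hu⟩ := hr
    obtain ⟨w, hw₁, hw₂⟩ := exists_between (lt_min hlt' (by linarith : c < c + ε))
    rw [lt_min_iff] at hw₂
    have hwS : w ∈ S := by
      refine ⟨hw₂.1.le, fun u h₁ h₂ => ?_⟩
      rcases lt_trichotomy u c with h | h | h
      · exact hlt u h₁ h
      · exact h ▸ hcv (h ▸ h₁)
      · exact hu u h (by linarith)
    exact absurd (hsup.1 hwS) hw₁.not_ge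

namespace TrainMotion

variable {dmin dmax : ℝ} {f : ℝ → TStat} {tm : ℕ → EReal}

theorem nonneg (h : TrainMotion dmin dmax f tm) (n : ℕ) : 0 ≤ tm n :=
  h.zero ▸ h.mono n.zero_le

theorem exists_real_of_ne_top (h : TrainMotion dmin dmax f tm) {n : ℕ} (hn : tm n ≠ ⊤) :
    ∃ r : ℝ, tm n = (r : EReal) :=
  ⟨(tm n).toReal, (EReal.coe_toReal hn
    (ne_of_gt (lt_of_lt_of_le (EReal.bot_lt_coe 0) (h.nonneg n)))).symm⟩

theorem exists_real_of_le (h : TrainMotion dmin dmax f tm) {m n : ℕ} {r : ℝ}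
    (hn : tm n = (r : EReal)) (hmn : m ≤ n) : ∃ q : ℝ, tm m = (q : EReal) :=
  h.exists_real_of_ne_top (ne_top_of_le_ne_top (hn ▸ EReal.coe_ne_top r) (h.mono hmn))

theorem exists_real_succ (h : TrainMotion dmin dmax f tm) {n : ℕ} {r : ℝ}
    (hn : tm n = (r : EReal)) (hdvd : ¬ 3 ∣ n) : ∃ q : ℝ, tm (n + 1) = (q : EReal) :=
  h.exists_real_of_ne_top fun htop =>
    hdvd (h.last_div n (hn ▸ EReal.coe_ne_top r) htop)

theorem real_nonneg (h : TrainMotion dmin dmax f tm) {n : ℕ} {r : ℝ}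
    (hn : tm n = (r : EReal)) : 0 ≤ r := by
  have := h.nonneg n
  rw [hn] at this
  exact_mod_cast this

theorem real_lt_succ (h : TrainMotion dmin dmax f tm) {n : ℕ} {r q : ℝ}
    (hn : tm n = (r : EReal)) (hn' : tm (n + 1) = (q : EReal)) : r < q := by
  have := h.strict n (hn ▸ EReal.coe_ne_top r)
  rw [hn, hn'] at this
  exact_mod_cast this

end TrainMotion

namespace RegularRun

variable {Tracks : Type*} {dmin dmax dopen dclose : ℝ} {tm : ℕ → EReal}

theorem deadline_eq_top (R : RegularRun Tracks dmin dmax dopen dclose) {x : Tracks}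
    (htm : TrainMotion dmin dmax (R.trackStatus x) tm) {i : ℕ} {α a : ℝ}
    (hα : tm (3 * i) = (α : EReal)) (ha : tm (3 * i + 1) = (a : EReal)) :
    ∀ t ∈ Set.Ioc α a, R.deadline x t = ⊤ := by
  have hα₀ := htm.real_nonneg hα
  have hstep : ∀ t, α ≤ t → t < a → RightVal (R.deadline x) t ⊤ := by
    intro t h₁ h₂
    have hemp : R.trackStatus x t = TStat.emp :=
      htm.status_empty i t (by rw [hα]; exact_mod_cast h₁) (by rw [ha]; exact_mod_cast h₂)
    have hplus : R.deadlinePlus x t = ⊤ := by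
      by_cases htop : R.deadline x t = ⊤
      · rw [R.dl_step_other x t (hα₀.trans h₁) (by simp [hemp]) (by simp [htop]), htop]
      · exact R.dl_step_empty x t (hα₀.trans h₁) hemp htop
    exact hplus ▸ R.dlPlus_spec x t (hα₀.trans h₁)
  exact eq_on_Ioc_of_leftVal_of_rightVal (hstep α le_rfl (htm.real_lt_succ hα ha))
    (fun t h₁ h₂ _ => hstep t h₁.le h₂) (fun t h₁ _ => R.dl_left x t (hα₀.trans_lt h₁))

theorem deadline_eq_arrival_add_waitTime (R : RegularRun Tracks dmin dmax dopen dclose)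
    {x : Tracks} (htm : TrainMotion dmin dmax (R.trackStatus x) tm) {i : ℕ} {α a b c : ℝ}
    (hα : tm (3 * i) = (α : EReal)) (ha : tm (3 * i + 1) = (a : EReal))
    (hb : tm (3 * i + 2) = (b : EReal)) (hc : tm (3 * i + 3) = (c : EReal)) :
    ∀ t ∈ Set.Ioc a c, R.deadline x t = ((a + (dmin - dclose) : ℝ) : EReal) := by
  have ha₀ := htm.real_nonneg ha
  have hab := htm.real_lt_succ ha hb
  refine eq_on_Ioc_of_leftVal_of_rightVal ?_ ?_ fun t h₁ _ => R.dl_left x t (ha₀.trans_lt h₁)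
  · have hcom : R.trackStatus x a = TStat.coming :=
      htm.status_coming i a ha.le (by rw [hb]; exact_mod_cast hab)
    have htop := R.deadline_eq_top htm hα ha a ⟨htm.real_lt_succ hα ha, le_rfl⟩
    exact R.dl_step_coming x a ha₀ hcom htop ▸ R.dlPlus_spec x a ha₀
  · intro t h₁ h₂ hv
    have hne : R.trackStatus x t ≠ TStat.emp := by
      rcases lt_or_ge t b with h | h
      · rw [htm.status_coming i t (by rw [ha]; exact_mod_cast h₁.le)
          (by rw [hb]; exact_mod_cast h)]
        simp
      · rw [htm.status_cross i t (by rw [hb]; exact_mod_cast h)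
          (by rw [hc]; exact_mod_cast h₂)]
        simp
    have hplus := R.dl_step_other x t (ha₀.trans h₁.le)
      (fun h => EReal.coe_ne_top _ (hv.symm.trans h.2)) (fun h => hne h.1)
    rw [hv] at hplus
    exact hplus ▸ R.dlPlus_spec x t (ha₀.trans h₁.le)

theorem deadline_ne_self_at_empty_start (R : RegularRun Tracks dmin dmax dopen dclose)
    (hdclose : 0 < dclose) {x : Tracks} (htm : TrainMotion dmin dmax (R.trackStatus x) tm)
    {i : ℕ} {α : ℝ} (hα : tm (3 * i) = (α : EReal)) : R.deadline x α ≠ (α : EReal) := by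
  cases i with
  | zero =>
    have : α = 0 := by
      have h := htm.zero
      rw [show (0 : ℕ) = 3 * 0 from rfl, hα] at h
      exact_mod_cast h
    rw [this, R.dl_init x]
    exact (EReal.coe_ne_top 0).symm
  | succ j =>
    have hc : tm (3 * j + 3) = (α : EReal) := hα
    obtain ⟨α', hα'⟩ := htm.exists_real_of_le (m := 3 * j) hc (by omega)
    obtain ⟨a, ha⟩ := htm.exists_real_of_le (m := 3 * j + 1) hc (by omega)
    obtain ⟨b, hb⟩ := htm.exists_real_of_le (m := 3 * j + 2) hc (by omega)
    have hab := htm.real_lt_succ ha hb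
    have hbc := htm.real_lt_succ hb hc
    have hgap := (htm.gap j a b ha hb).1
    rw [R.deadline_eq_arrival_add_waitTime htm hα' ha hb hc α ⟨hab.trans hbc, le_rfl⟩]
    exact fun h => by
      have : a + (dmin - dclose) = α := by exact_mod_cast h
      linarith

/-- The deadline of a track is not reached from the start of an empty period until `WaitTime`
after the next arrival. -/
theorem deadline_ne_self (R : RegularRun Tracks dmin dmax dopen dclose)
    (hdclose : 0 < dclose) {x : Tracks} (htm : TrainMotion dmin dmax (R.trackStatus x) tm)
    {i : ℕ} {α a : ℝ} (hα : tm (3 * i) = (α : EReal)) (ha : tm (3 * i + 1) = (a : EReal)) :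
    ∀ t ∈ Set.Ico α (a + (dmin - dclose)), R.deadline x t ≠ (t : EReal) := by
  rintro t ⟨h₁, h₂⟩
  rcases h₁.eq_or_lt with rfl | h₁
  · exact R.deadline_ne_self_at_empty_start hdclose htm hα
  rcases le_or_gt t a with hta | hta
  · rw [R.deadline_eq_top htm hα ha t ⟨h₁, hta⟩]
    exact (EReal.coe_ne_top t).symm
  · obtain ⟨b, hb⟩ := htm.exists_real_succ ha (by omega)
    obtain ⟨c, hc⟩ := htm.exists_real_succ hb (by omega)
    have hbc := htm.real_lt_succ hb hc
    have hgap := (htm.gap i a b ha hb).1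
    rw [R.deadline_eq_arrival_add_waitTime htm hα ha hb hc t ⟨hta, by linarith⟩]
    exact_mod_cast h₂.ne'

end RegularRun

theorem local_safe_to_open_5 {Tracks : Type*} [Fintype Tracks] [Nonempty Tracks]
    {dmin dmax dopen dclose : ℝ}
    (hdmin : 0 < dmin) (hdmax : 0 < dmax) (hdopen : 0 < dopen) (hdclose : 0 < dclose)
    (hcm : dclose < dmin) (hmm : dmin ≤ dmax)
    (R : RegularRun Tracks dmin dmax dopen dclose)
    (x : Tracks) (tm : ℕ → EReal) (htm : TrainMotion dmin dmax (R.trackStatus x) tm)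
    (α β : ℝ)
    (hmax :
      (dopen < dmin - dclose ∧ ∃ i : ℕ, ∃ a : ℝ, tm (3 * i) = (α : EReal) ∧
          tm (3 * i + 1) = (a : EReal) ∧ β = a + (dmin - dclose) - dopen) ∨
      (dmin - dclose ≤ dopen ∧ ∃ i : ℕ, tm (3 * i) = (α : EReal) ∧
          tm (3 * i + 1) = (β : EReal))) :
    (∀ t ∈ Set.Icc α β, R.deadline x t ≠ (t : EReal)) ∧
    (∃ ε : ℝ, 0 < ε ∧ ∀ t ∈ Set.Ioo β (β + ε), R.deadline x t ≠ (t : EReal)) := by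
  obtain ⟨a, hαβ, hβ, hne⟩ : ∃ a : ℝ, α ≤ β ∧ β < a + (dmin - dclose) ∧
      ∀ t ∈ Set.Ico α (a + (dmin - dclose)), R.deadline x t ≠ (t : EReal) := by
    rcases hmax with ⟨hw, i, a, hα, ha, rfl⟩ | ⟨-, i, hα, hβ⟩
    · have := htm.real_lt_succ hα ha
      exact ⟨a, by linarith, by linarith, R.deadline_ne_self hdclose htm hα ha⟩
    · have := htm.real_lt_succ hα hβ
      exact ⟨β, by linarith, by linarith, R.deadline_ne_self hdclose htm hα hβ⟩
  refine ⟨fun t ht => hne t ⟨ht.1, ht.2.trans_lt hβ⟩, a + (dmin - dclose) - β, by linarith, ?_⟩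
  exact fun t ht => hne t ⟨hαβ.trans ht.1.le, by linarith [ht.2]⟩

end RailCross
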